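/- Let d ≥ 2 be an integer and let s, r, δ ∈ ℝ satisfy δ > 1, d > 1 + δ − 2r, r ≤ 1, and s > d/2. Then the following are equivalent: (i) there exists C > 0 such that for all measurable F, G : ℝ^d → [0,∞), ∫_{ℝ^d} ω_{s,r,δ}(ξ) (F∗G)(ξ)² dξ ≤ C² (∫_{ℝ^d} ω_{s,r,δ}(ξ) F(ξ)² dξ)(∫_{ℝ^d} ω_{s,r,δ}(ξ) G(ξ)² dξ); (ii) there exists C > 0 such that for all measurable F, G, H : ℝ^d → [0,∞) with finite L² norms, I(F, G, H) ≤ C ‖F‖_{L²} ‖G‖_{L²} ‖H‖_{L²}. (Statement (i) expresses that X^s_{r,δ}(ℝ^d) is a Banach algebra under pointwise multiplication.) -/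

import Mathlib

open MeasureTheory

/-- The anisotropic weight `ω_{s,r,δ}`. -/
noncomputable def omegaW (d : ℕ) (hd : 0 < d) (s r δ : ℝ)
    (ξ : EuclideanSpace ℝ (Fin d)) : ENNReal :=
  if ‖ξ‖ < 1 then ENNReal.ofReal ((|ξ ⟨0, hd⟩| ^ 2 + ‖ξ‖ ^ (2 * δ)) / ‖ξ‖ ^ (2 * r))
  else ENNReal.ofReal ((1 + ‖ξ‖ ^ 2) ^ s)

/-- The function `μ_{r,δ}(ξ) = (|ξ₁| + |ξ|^δ)/|ξ|^r`. -/
noncomputable def muW (d : ℕ) (hd : 0 < d) (r δ : ℝ)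
    (ξ : EuclideanSpace ℝ (Fin d)) : ℝ :=
  (|ξ ⟨0, hd⟩| + ‖ξ‖ ^ δ) / ‖ξ‖ ^ r

/-- Convolution of two nonnegative functions, valued in `[0,∞]`. -/
noncomputable def convNN (d : ℕ) (F G : EuclideanSpace ℝ (Fin d) → ℝ)
    (ξ : EuclideanSpace ℝ (Fin d)) : ENNReal :=
  ∫⁻ η, ENNReal.ofReal (F (ξ - η)) * ENNReal.ofReal (G η)

/-- The trilinear functional `I(F,G,H)`. -/
noncomputable def Itri (d : ℕ) (hd : 0 < d) (r δ : ℝ)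
    (F G H : EuclideanSpace ℝ (Fin d) → ℝ) : ENNReal :=
  ∫⁻ ξ in Metric.ball (0 : EuclideanSpace ℝ (Fin d)) 1,
    ∫⁻ η in Metric.ball (0 : EuclideanSpace ℝ (Fin d)) 1,
      ENNReal.ofReal (muW d hd r δ (ξ + η) / (muW d hd r δ ξ * muW d hd r δ η)) *
        ENNReal.ofReal (F ξ) * ENNReal.ofReal (G η) * ENNReal.ofReal (H (ξ + η))

open scoped ENNReal

section ENNReal

theorem ENNReal.rpow_half_sq (a : ℝ≥0∞) : (a ^ (1 / 2 : ℝ)) ^ 2 = a := by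
  rw [← ENNReal.rpow_mul_natCast]
  norm_num

theorem ENNReal.le_of_sq_le_sq {a b : ℝ≥0∞} (h : a ^ 2 ≤ b ^ 2) : a ≤ b := by
  rwa [← ENNReal.rpow_two, ← ENNReal.rpow_two, ENNReal.rpow_le_rpow_iff zero_lt_two] at h

theorem ENNReal.add_sq_le_two_mul (a b : ℝ≥0∞) : (a + b) ^ 2 ≤ 2 * (a ^ 2 + b ^ 2) := by
  have h := ENNReal.rpow_add_le_mul_rpow_add_rpow a b one_le_two
  norm_num at h
  exact h

theorem ENNReal.exists_le_ofReal_sq {M : ℝ≥0∞} (hM : M ≠ ∞) :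
    ∃ C : ℝ, 0 < C ∧ M ≤ ENNReal.ofReal C ^ 2 := by
  refine ⟨M.toReal + 1, by positivity, ?_⟩
  rw [← ENNReal.ofReal_pow (by positivity)]
  refine ENNReal.le_ofReal_iff_toReal_le hM (by positivity) |>.2 ?_
  nlinarith [M.toReal_nonneg]

/-- A weak converse to the Cauchy-Schwarz inequality. -/
theorem setLIntegral_sq_le_of_forall_lintegral_mul_le {α : Type*} [MeasurableSpace α]
    {μ : Measure α} {u : α → ℝ≥0∞} (hu : Measurable u) {s : Set α} (hs : MeasurableSet s)
    (hμs : μ s ≠ ∞) {A : ℝ≥0∞}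
    (h : ∀ H : α → ℝ, Measurable H → (∀ x, 0 ≤ H x) → ∫⁻ x, ENNReal.ofReal (H x) ^ 2 ∂μ < ∞ →
      ∫⁻ x, u x * ENNReal.ofReal (H x) ∂μ ≤
        A * (∫⁻ x, ENNReal.ofReal (H x) ^ 2 ∂μ) ^ (1 / 2 : ℝ)) :
    ∫⁻ x in s, u x ^ 2 ∂μ ≤ A ^ 2 := by
  have key : ∀ n : ℕ, ∫⁻ x in s, (min (u x) n) ^ 2 ∂μ ≤ A ^ 2 := fun n => by
    set H : α → ℝ := s.indicator fun x => (min (u x) n).toReal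
    have hH : ∀ x, ENNReal.ofReal (H x) = s.indicator (fun x => min (u x) n) x := fun x => by
      by_cases hx : x ∈ s
      · simp only [H, Set.indicator_of_mem hx]
        exact ENNReal.ofReal_toReal (min_lt_of_right_lt (ENNReal.natCast_lt_top n)).ne
      · simp [H, Set.indicator_of_notMem hx]
    have hI : ∫⁻ x, ENNReal.ofReal (H x) ^ 2 ∂μ = ∫⁻ x in s, (min (u x) n) ^ 2 ∂μ := by
      rw [← lintegral_indicator hs]
      refine lintegral_congr fun x => ?_
      rw [hH]
      by_cases hx : x ∈ s <;> simp [hx]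
    have hfin : ∫⁻ x in s, (min (u x) n) ^ 2 ∂μ < ∞ := calc
      ∫⁻ x in s, (min (u x) n) ^ 2 ∂μ ≤ ∫⁻ _ in s, (n : ℝ≥0∞) ^ 2 ∂μ :=
        lintegral_mono fun x => by gcongr; exact min_le_right _ _
      _ = (n : ℝ≥0∞) ^ 2 * μ s := setLIntegral_const _ _
      _ < ∞ := by finiteness
    have h1 := h H (Measurable.indicator (by fun_prop) hs)
      (Set.indicator_nonneg fun x _ => ENNReal.toReal_nonneg) (hI ▸ hfin)
    have h2 : ∫⁻ x, ENNReal.ofReal (H x) ^ 2 ∂μ ≤ ∫⁻ x, u x * ENNReal.ofReal (H x) ∂μ := by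
      refine lintegral_mono fun x => ?_
      rw [pow_two, hH]
      gcongr
      exact (Set.indicator_le_self' (fun _ _ => zero_le) x).trans (min_le_left _ _)
    rw [hI] at h1 h2
    set J := ∫⁻ x in s, (min (u x) n) ^ 2 ∂μ
    have h3 : (J ^ (1 / 2 : ℝ)) * J ^ (1 / 2 : ℝ) ≤ A * J ^ (1 / 2 : ℝ) := by
      rw [← pow_two, ENNReal.rpow_half_sq]
      exact h2.trans h1
    rcases eq_or_ne J 0 with hJ | hJ
    · simp [hJ]
    · rw [ENNReal.mul_le_mul_iff_left (by simp [hJ]) (by finiteness)] at h3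
      calc J = (J ^ (1 / 2 : ℝ)) ^ 2 := (ENNReal.rpow_half_sq J).symm
        _ ≤ A ^ 2 := by gcongr
  refine le_of_tendsto' (lintegral_tendsto_of_tendsto_of_monotone (fun n => by fun_prop)
    (Filter.Eventually.of_forall fun x m n hmn => ?_)
    (Filter.Eventually.of_forall fun x => ?_)) key
  · exact pow_le_pow_left' (min_le_min_left _ (Nat.cast_le.2 hmn)) 2
  · refine ((ENNReal.continuous_pow 2).tendsto _).comp ?_
    simpa using (tendsto_const_nhds (x := u x)).min ENNReal.tendsto_nat_nhds_top

end ENNReal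

section Convolution

theorem sq_lintegral_mul_le {α : Type*} [MeasurableSpace α] (μ : Measure α) {f g : α → ℝ≥0∞}
    (hf : AEMeasurable f μ) (hg : AEMeasurable g μ) :
    (∫⁻ a, f a * g a ∂μ) ^ 2 ≤ (∫⁻ a, f a ^ 2 ∂μ) * ∫⁻ a, g a ^ 2 ∂μ := by
  have h := ENNReal.lintegral_mul_le_Lp_mul_Lq μ Real.HolderConjugate.two_two hf hg
  simp only [Pi.mul_apply, ENNReal.rpow_two] at h
  calc (∫⁻ a, f a * g a ∂μ) ^ 2
      ≤ ((∫⁻ a, f a ^ 2 ∂μ) ^ (1 / 2 : ℝ) * (∫⁻ a, g a ^ 2 ∂μ) ^ (1 / 2 : ℝ)) ^ 2 := by gcongr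
    _ = _ := by
      rw [mul_pow, ENNReal.rpow_half_sq, ENNReal.rpow_half_sq]

variable {E : Type*} [AddCommGroup E] [MeasurableSpace E] [MeasurableAdd₂ E] [MeasurableNeg E]
  (μ : Measure E) [μ.IsAddLeftInvariant]

theorem lintegral_conv_comm [μ.IsNegInvariant] (f g : E → ℝ≥0∞) (x : E) :
    ∫⁻ y, f (x - y) * g y ∂μ = ∫⁻ y, g (x - y) * f y ∂μ := by
  rw [← lintegral_sub_left_eq_self _ x]
  simp [mul_comm]

variable [SFinite μ]

theorem lintegral_conv_sq_le {f g : E → ℝ≥0∞} (hf : Measurable f) (hg : Measurable g) :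
    ∫⁻ x, (∫⁻ y, f (x - y) * g y ∂μ) ^ 2 ∂μ ≤ (∫⁻ y, g y ∂μ) ^ 2 * ∫⁻ x, f x ^ 2 ∂μ := by
  have key : ∀ x, (∫⁻ y, f (x - y) * g y ∂μ) ^ 2 ≤
      (∫⁻ y, f (x - y) ^ 2 * g y ∂μ) * ∫⁻ y, g y ∂μ := fun x => by
    have h := sq_lintegral_mul_le μ (f := fun y => f (x - y) * g y ^ (1 / 2 : ℝ))
      (g := fun y => g y ^ (1 / 2 : ℝ)) (by fun_prop) (by fun_prop)
    simpa only [mul_assoc, ← pow_two, mul_pow, ENNReal.rpow_half_sq] using h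
  calc ∫⁻ x, (∫⁻ y, f (x - y) * g y ∂μ) ^ 2 ∂μ
      ≤ ∫⁻ x, (∫⁻ y, f (x - y) ^ 2 * g y ∂μ) * ∫⁻ y, g y ∂μ ∂μ := lintegral_mono key
    _ = (∫⁻ y, (∫⁻ x, f (x - y) ^ 2 ∂μ) * g y ∂μ) * ∫⁻ y, g y ∂μ := by
      rw [lintegral_mul_const, lintegral_lintegral_swap]
      · congr 2
        ext y
        rw [lintegral_mul_const _ (by fun_prop)]
      · fun_prop
      · exact Measurable.lintegral_prod_right' (f := fun p : E × E => f (p.1 - p.2) ^ 2 * g p.2)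
          (by fun_prop)
    _ = _ := by
      simp only [lintegral_sub_right_eq_self (fun x => f x ^ 2)]
      rw [lintegral_const_mul _ hg]
      ring

theorem lintegral_lintegral_add_mul {Φ f g : E → ℝ≥0∞} (hΦ : Measurable Φ) (hf : Measurable f)
    (hg : Measurable g) :
    ∫⁻ x, ∫⁻ y, Φ (x + y) * f x * g y ∂μ ∂μ = ∫⁻ x, Φ x * ∫⁻ y, f (x - y) * g y ∂μ ∂μ := by
  rw [lintegral_lintegral_swap (by fun_prop)]
  have : ∀ y, ∫⁻ x, Φ (x + y) * f x * g y ∂μ = ∫⁻ x, Φ x * f (x - y) * g y ∂μ := fun y => by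
    rw [← lintegral_add_right_eq_self (fun x => Φ x * f (x - y) * g y) y]
    simp only [add_sub_cancel_right]
  simp only [this]
  rw [lintegral_lintegral_swap (by fun_prop)]
  congr with x
  rw [← lintegral_const_mul _ (by fun_prop)]
  simp only [mul_assoc]

end Convolution

section Weights

variable {d : ℕ} (hd : 0 < d) {s r δ : ℝ}

theorem muW_nonneg (ξ : EuclideanSpace ℝ (Fin d)) : 0 ≤ muW d hd r δ ξ := by
  unfold muW; positivity

theorem muW_pos {ξ : EuclideanSpace ℝ (Fin d)} (hξ : ξ ≠ 0) : 0 < muW d hd r δ ξ := by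
  have := norm_pos_iff.2 hξ
  unfold muW; positivity

theorem measurable_muW : Measurable (muW d hd r δ) := by
  unfold muW; fun_prop

theorem measurable_omegaW : Measurable (omegaW d hd s r δ) := by
  unfold omegaW
  exact Measurable.ite (measurableSet_lt (by fun_prop) (by fun_prop)) (by fun_prop) (by fun_prop)

theorem omegaW_of_norm_lt_one {ξ : EuclideanSpace ℝ (Fin d)} (hξ : ‖ξ‖ < 1) :
    omegaW d hd s r δ ξ =
      ENNReal.ofReal ((|ξ ⟨0, hd⟩| ^ 2 + (‖ξ‖ ^ δ) ^ 2) / (‖ξ‖ ^ r) ^ 2) := by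
  have h : ∀ a : ℝ, ‖ξ‖ ^ (2 * a) = (‖ξ‖ ^ a) ^ 2 := fun a => by
    rw [mul_comm, Real.rpow_mul (norm_nonneg _), Real.rpow_two]
  rw [omegaW, if_pos hξ, h, h]

theorem omegaW_of_one_le_norm {ξ : EuclideanSpace ℝ (Fin d)} (hξ : 1 ≤ ‖ξ‖) :
    omegaW d hd s r δ ξ = ENNReal.ofReal ((1 + ‖ξ‖ ^ 2) ^ s) := by
  rw [omegaW, if_neg hξ.not_gt]

theorem omegaW_ne_top (ξ : EuclideanSpace ℝ (Fin d)) : omegaW d hd s r δ ξ ≠ ∞ := by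
  unfold omegaW; split_ifs <;> exact ENNReal.ofReal_ne_top

theorem omegaW_ne_zero {ξ : EuclideanSpace ℝ (Fin d)} (hξ : ξ ≠ 0) :
    omegaW d hd s r δ ξ ≠ 0 := by
  have := norm_pos_iff.2 hξ
  unfold omegaW
  split_ifs <;> exact (ENNReal.ofReal_pos.2 (by positivity)).ne'

theorem omegaW_le_muW_sq {ξ : EuclideanSpace ℝ (Fin d)} (hξ : ‖ξ‖ < 1) :
    omegaW d hd s r δ ξ ≤ ENNReal.ofReal (muW d hd r δ ξ) ^ 2 := by
  rw [omegaW_of_norm_lt_one hd hξ, ← ENNReal.ofReal_pow (muW_nonneg hd ξ)]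
  apply ENNReal.ofReal_le_ofReal
  rw [muW, div_pow]
  gcongr
  have : 0 ≤ |ξ ⟨0, hd⟩| * ‖ξ‖ ^ δ := by positivity
  linarith [add_sq |ξ ⟨0, hd⟩| (‖ξ‖ ^ δ)]

theorem muW_sq_le_omegaW {ξ : EuclideanSpace ℝ (Fin d)} (hξ : ‖ξ‖ < 1) :
    ENNReal.ofReal (muW d hd r δ ξ) ^ 2 ≤ 2 * omegaW d hd s r δ ξ := by
  rw [omegaW_of_norm_lt_one hd hξ, ← ENNReal.ofReal_pow (muW_nonneg hd ξ)]
  have h : muW d hd r δ ξ ^ 2 ≤ 2 * ((|ξ ⟨0, hd⟩| ^ 2 + (‖ξ‖ ^ δ) ^ 2) / (‖ξ‖ ^ r) ^ 2) := by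
    rw [muW, div_pow, ← mul_div_assoc]
    gcongr
    exact add_sq_le
  exact (ENNReal.ofReal_le_ofReal h).trans_eq
    ((ENNReal.ofReal_mul zero_le_two).trans (by rw [ENNReal.ofReal_ofNat 2]))

theorem one_le_omegaW (hs : 0 ≤ s) {ξ : EuclideanSpace ℝ (Fin d)} (hξ : 1 ≤ ‖ξ‖) :
    1 ≤ omegaW d hd s r δ ξ := by
  rw [omegaW_of_one_le_norm hd hξ, ENNReal.one_le_ofReal]
  exact Real.one_le_rpow (by nlinarith [norm_nonneg ξ]) hs

theorem muW_le_of_one_le_norm (hδ : 0 ≤ δ) {ξ : EuclideanSpace ℝ (Fin d)} (h1 : 1 ≤ ‖ξ‖)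
    (h2 : ‖ξ‖ ≤ 2) : muW d hd r δ ξ ≤ (2 + 2 ^ δ) * 2 ^ |r| := by
  rw [muW, div_eq_mul_inv, ← Real.rpow_neg (norm_nonneg _)]
  have h3 : |ξ ⟨0, hd⟩| ≤ ‖ξ‖ := PiLp.norm_apply_le ξ _
  have h4 : ‖ξ‖ ^ (-r) ≤ 2 ^ |r| := calc
    ‖ξ‖ ^ (-r) ≤ ‖ξ‖ ^ |r| := Real.rpow_le_rpow_of_exponent_le h1 (neg_le_abs r)
    _ ≤ 2 ^ |r| := by gcongr
  have h5 : ‖ξ‖ ^ δ ≤ 2 ^ δ := by gcongr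
  gcongr
  linarith

/-- Up to a constant, `μ²` is dominated by `ω` on the ball of radius two. -/
theorem exists_muW_sq_le_omegaW (hδ : 0 ≤ δ) (hs : 0 ≤ s) : ∃ K : ℝ≥0∞, K ≠ ∞ ∧
    ∀ ξ : EuclideanSpace ℝ (Fin d), ‖ξ‖ < 2 →
      ENNReal.ofReal (muW d hd r δ ξ) ^ 2 ≤ K * omegaW d hd s r δ ξ := by
  refine ⟨2 + ENNReal.ofReal ((2 + 2 ^ δ) * 2 ^ |r|) ^ 2, by finiteness, fun ξ hξ => ?_⟩
  rw [add_mul]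
  rcases lt_or_ge ‖ξ‖ 1 with h | h
  · exact (muW_sq_le_omegaW hd h).trans le_self_add
  · calc ENNReal.ofReal (muW d hd r δ ξ) ^ 2
        ≤ ENNReal.ofReal ((2 + 2 ^ δ) * 2 ^ |r|) ^ 2 * 1 := by
          rw [mul_one]
          gcongr
          exact muW_le_of_one_le_norm hd hδ h hξ.le
      _ ≤ ENNReal.ofReal ((2 + 2 ^ δ) * 2 ^ |r|) ^ 2 * omegaW d hd s r δ ξ := by
          gcongr
          exact one_le_omegaW hd hs h
      _ ≤ _ := le_add_self

theorem omegaW_le_two (hδ : 1 < δ) (hr : r ≤ 1) {ξ : EuclideanSpace ℝ (Fin d)} (hξ : ‖ξ‖ < 1) :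
    omegaW d hd s r δ ξ ≤ 2 := by
  rw [omegaW, if_pos hξ]
  refine (ENNReal.ofReal_le_ofReal ?_).trans_eq (ENNReal.ofReal_ofNat 2)
  rcases (norm_nonneg ξ).eq_or_lt with h0 | h0
  · have : ξ = 0 := norm_eq_zero.1 h0.symm
    subst this
    simp [Real.zero_rpow (show 2 * δ ≠ 0 by linarith)]
  have h3 : |ξ ⟨0, hd⟩| ≤ ‖ξ‖ := PiLp.norm_apply_le ξ _
  rw [div_le_iff₀ (by positivity)]
  have e1 : ‖ξ‖ ^ (2 * δ) ≤ ‖ξ‖ ^ (2 * r) :=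
    Real.rpow_le_rpow_of_exponent_ge h0 hξ.le (by linarith)
  have e2 : ‖ξ‖ ^ (2 : ℝ) ≤ ‖ξ‖ ^ (2 * r) :=
    Real.rpow_le_rpow_of_exponent_ge h0 hξ.le (by linarith)
  rw [Real.rpow_two] at e2
  have e3 : |ξ ⟨0, hd⟩| ^ 2 ≤ ‖ξ‖ ^ 2 := by gcongr
  linarith

theorem le_omegaW_of_half_le_norm (hδ : 1 < δ) (hr : r ≤ 1) {ξ : EuclideanSpace ℝ (Fin d)}
    (h2 : 1 / 2 ≤ ‖ξ‖) (hξ : ‖ξ‖ < 1) :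
    ENNReal.ofReal ((2 ^ (2 * δ - 2 * r))⁻¹) ≤ omegaW d hd s r δ ξ := by
  rw [omegaW, if_pos hξ]
  apply ENNReal.ofReal_le_ofReal
  have h0 : 0 < ‖ξ‖ := by linarith
  calc ((2 : ℝ) ^ (2 * δ - 2 * r))⁻¹ = (1 / 2) ^ (2 * δ - 2 * r) := by
        rw [one_div, Real.inv_rpow zero_le_two]
    _ ≤ ‖ξ‖ ^ (2 * δ - 2 * r) := Real.rpow_le_rpow (by norm_num) h2 (by linarith)
    _ = ‖ξ‖ ^ (2 * δ) / ‖ξ‖ ^ (2 * r) := Real.rpow_sub h0 _ _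
    _ ≤ _ := by
      gcongr
      exact le_add_of_nonneg_left (by positivity)

/-- The weight of a sum is controlled by the weight of the larger summand, unless everything
happens in the unit ball. -/
theorem omegaW_add_le (hδ : 1 < δ) (hr : r ≤ 1) (hs : 0 ≤ s) {x y : EuclideanSpace ℝ (Fin d)}
    (hyx : ‖y‖ ≤ ‖x‖) (h : ¬(‖x‖ < 1 ∧ ‖x + y‖ < 1)) :
    omegaW d hd s r δ (x + y) ≤
      ENNReal.ofReal (2 * (5 ^ s * 2 ^ (2 * δ - 2 * r))) * omegaW d hd s r δ x := by
  have h5 : (1 : ℝ) ≤ 5 ^ s := Real.one_le_rpow (by norm_num) hs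
  have h2 : (1 : ℝ) ≤ 2 ^ (2 * δ - 2 * r) := Real.one_le_rpow (by norm_num) (by linarith)
  have hn := norm_add_le x y
  rcases lt_or_ge ‖x + y‖ 1 with hxy | hxy
  · have hx : 1 ≤ ‖x‖ := by
      by_contra hx
      exact h ⟨not_le.1 hx, hxy⟩
    calc omegaW d hd s r δ (x + y) ≤ 2 * 1 := by
          rw [mul_one]; exact omegaW_le_two hd hδ hr hxy
      _ ≤ _ := by
        gcongr
        · rw [← ENNReal.ofReal_ofNat]
          apply ENNReal.ofReal_le_ofReal
          nlinarith
        · exact one_le_omegaW hd hs hx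
  rw [omegaW_of_one_le_norm hd hxy]
  rcases lt_or_ge ‖x‖ 1 with hx | hx
  · calc ENNReal.ofReal ((1 + ‖x + y‖ ^ 2) ^ s)
        ≤ ENNReal.ofReal (5 ^ s * 2 ^ (2 * δ - 2 * r)) *
            ENNReal.ofReal ((2 ^ (2 * δ - 2 * r))⁻¹) := by
          rw [← ENNReal.ofReal_mul (by positivity), mul_assoc,
            mul_inv_cancel₀ (by positivity), mul_one]
          apply ENNReal.ofReal_le_ofReal
          gcongr
          nlinarith [norm_nonneg (x + y)]
      _ ≤ _ := by
        gcongr ENNReal.ofReal ?_ * ?_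
        · exact le_mul_of_one_le_left (by positivity) one_le_two
        · exact le_omegaW_of_half_le_norm hd hδ hr (by linarith) hx
  · rw [omegaW_of_one_le_norm hd hx, ← ENNReal.ofReal_mul (by positivity)]
    apply ENNReal.ofReal_le_ofReal
    calc (1 + ‖x + y‖ ^ 2) ^ s ≤ (5 * (1 + ‖x‖ ^ 2)) ^ s := by
          gcongr
          nlinarith [norm_nonneg (x + y)]
      _ = 5 ^ s * (1 + ‖x‖ ^ 2) ^ s := Real.mul_rpow (by norm_num) (by positivity)
      _ ≤ _ := by
        gcongr
        nlinarith

end Weights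

section Integrability

theorem integrable_indicator_abs_rpow_neg {e : ℝ} (he : e < 1) :
    Integrable ((Set.Icc (-1 : ℝ) 1).indicator fun t => |t| ^ (-e)) := by
  rw [integrable_indicator_iff measurableSet_Icc, ← Set.Icc_union_Icc_eq_Icc (b := 0)
    (by norm_num) zero_le_one]
  have h : IntegrableOn (fun t : ℝ => |t| ^ (-e)) (Set.Icc 0 1) := by
    have h0 := intervalIntegral.intervalIntegrable_rpow' (a := 0) (b := 1) (r := -e) (by linarith)
    rw [intervalIntegrable_iff_integrableOn_Icc_of_le zero_le_one] at h0
    exact h0.congr_fun (fun t ht => by simp only [abs_of_nonneg ht.1]) measurableSet_Icc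
  refine IntegrableOn.union ?_ h
  rw [← (Measure.measurePreserving_neg (volume : Measure ℝ)).integrableOn_comp_preimage
    (Homeomorph.neg ℝ).measurableEmbedding] at h
  simpa [Function.comp_def] using h

variable {d : ℕ} (hd : 0 < d) {s r δ : ℝ}

theorem prod_abs_rpow_le {b c : ℝ} (hc : 0 ≤ c) (ξ : EuclideanSpace ℝ (Fin d)) :
    ∏ i, |ξ i| ^ (if i = ⟨0, hd⟩ then b else c) ≤
      |ξ ⟨0, hd⟩| ^ b * ‖ξ‖ ^ (c * ((d : ℝ) - 1)) := by
  rw [← Finset.mul_prod_erase _ _ (Finset.mem_univ ⟨0, hd⟩), if_pos rfl]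
  gcongr
  calc ∏ i ∈ Finset.univ.erase ⟨0, hd⟩, |ξ i| ^ (if i = ⟨0, hd⟩ then b else c)
      ≤ ∏ i ∈ Finset.univ.erase (⟨0, hd⟩ : Fin d), ‖ξ‖ ^ c := by
        refine Finset.prod_le_prod (fun i _ => by positivity) fun i hi => ?_
        rw [if_neg (Finset.ne_of_mem_erase hi)]
        have : |ξ i| ≤ ‖ξ‖ := PiLp.norm_apply_le ξ i
        gcongr
    _ = ‖ξ‖ ^ (c * ((d : ℝ) - 1)) := by
        rw [Finset.prod_const, Finset.card_erase_of_mem (Finset.mem_univ _), Finset.card_univ,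
          Fintype.card_fin, Real.rpow_mul (norm_nonneg _), ← Nat.cast_pred hd, Real.rpow_natCast]

theorem prod_abs_rpow_le_omegaW {θ c : ℝ} (hθ : 0 ≤ θ) (hθ1 : θ ≤ 1) (hc : 0 ≤ c)
    (hcd : 2 * δ * (1 - θ) - 2 * r ≤ c * ((d : ℝ) - 1)) {ξ : EuclideanSpace ℝ (Fin d)}
    (h0 : ξ ≠ 0) (h1 : ‖ξ‖ < 1) :
    ENNReal.ofReal (∏ i, |ξ i| ^ (if i = ⟨0, hd⟩ then 2 * θ else c)) ≤ omegaW d hd s r δ ξ := by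
  rw [omegaW, if_pos h1]
  apply ENNReal.ofReal_le_ofReal
  have hξ := norm_pos_iff.2 h0
  calc ∏ i, |ξ i| ^ (if i = ⟨0, hd⟩ then 2 * θ else c)
      ≤ |ξ ⟨0, hd⟩| ^ (2 * θ) * ‖ξ‖ ^ (c * ((d : ℝ) - 1)) := prod_abs_rpow_le hd hc ξ
    _ ≤ |ξ ⟨0, hd⟩| ^ (2 * θ) * ‖ξ‖ ^ (2 * δ * (1 - θ) - 2 * r) := by
        gcongr 1
        exact Real.rpow_le_rpow_of_exponent_ge hξ h1.le hcd
    _ = (|ξ ⟨0, hd⟩| ^ 2) ^ θ * (‖ξ‖ ^ (2 * δ)) ^ (1 - θ) / ‖ξ‖ ^ (2 * r) := by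
        rw [Real.rpow_sub hξ, Real.rpow_mul (abs_nonneg _), Real.rpow_two,
          Real.rpow_mul (norm_nonneg ξ) (2 * δ), mul_div_assoc]
    _ ≤ (θ * |ξ ⟨0, hd⟩| ^ 2 + (1 - θ) * ‖ξ‖ ^ (2 * δ)) / ‖ξ‖ ^ (2 * r) := by
        gcongr
        exact Real.geom_mean_le_arith_mean2_weighted hθ (by linarith) (by positivity)
          (by positivity) (by ring)
    _ ≤ (|ξ ⟨0, hd⟩| ^ 2 + ‖ξ‖ ^ (2 * δ)) / ‖ξ‖ ^ (2 * r) := by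
        gcongr
        · exact mul_le_of_le_one_left (by positivity) hθ1
        · exact mul_le_of_le_one_left (by positivity) (by linarith)

theorem ae_forall_apply_ne_zero : ∀ᵐ ξ : EuclideanSpace ℝ (Fin d), ∀ i, ξ i ≠ 0 := by
  rw [ae_all_iff]
  intro i
  exact (PiLp.volume_preserving_ofLp (Fin d)).quasiMeasurePreserving.ae
    (Measure.ae_eval_ne (μ := fun _ => volume) i 0)

theorem setLIntegral_ball_inv_omegaW_lt_top (hd2 : 2 ≤ d) (hδ : 1 < δ)
    (hdim : 1 + δ - 2 * r < (d : ℝ)) :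
    ∫⁻ ξ in Metric.ball 0 1, (omegaW d hd s r δ ξ)⁻¹ < ∞ := by
  have hd1 : (0 : ℝ) < d - 1 := by
    have : (2 : ℝ) ≤ d := by exact_mod_cast hd2
    linarith
  obtain ⟨θ, hθ0, hθ, hθd⟩ : ∃ θ : ℝ, 0 ≤ θ ∧ θ < 1 / 2 ∧
      2 * δ * (1 - θ) - 2 * r < (d : ℝ) - 1 := by
    set ε := min (1 / 4) (((d : ℝ) - 1 - δ + 2 * r) / (4 * δ))
    have h1 : ε ≤ 1 / 4 := min_le_left _ _
    have h2 : ε * (4 * δ) ≤ (d : ℝ) - 1 - δ + 2 * r :=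
      (le_div_iff₀ (by linarith)).1 (min_le_right _ _)
    have h3 : 0 < ε := lt_min (by norm_num) (div_pos (by linarith) (by linarith))
    exact ⟨1 / 2 - ε, by linarith, by linarith, by nlinarith⟩
  set c := max 0 (2 * δ * (1 - θ) - 2 * r) / ((d : ℝ) - 1) with hc
  have hc0 : 0 ≤ c := by positivity
  have hc1 : c < 1 := (div_lt_one hd1).2 (max_lt hd1 hθd)
  have hcd : 2 * δ * (1 - θ) - 2 * r ≤ c * ((d : ℝ) - 1) := by
    rw [hc, div_mul_cancel₀ _ hd1.ne']
    exact le_max_right _ _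
  set e : Fin d → ℝ := fun i => if i = ⟨0, hd⟩ then 2 * θ else c
  have he : ∀ i, e i < 1 := fun i => by
    simp only [e]
    split_ifs <;> linarith
  have hint := Integrable.fintype_prod (μ := fun _ => volume)
    fun i => integrable_indicator_abs_rpow_neg (he i)
  have hint' := (PiLp.volume_preserving_ofLp (Fin d)).integrable_comp_of_integrable hint
  refine lt_of_le_of_lt ?_ hint'.lintegral_lt_top
  refine (lintegral_mono_ae ?_).trans (setLIntegral_le_lintegral _ _)
  filter_upwards [ae_restrict_mem Metric.isOpen_ball.measurableSet,
    ae_restrict_of_ae ae_forall_apply_ne_zero] with ξ hξ hne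
  rw [mem_ball_zero_iff] at hξ
  have h0 : ξ ≠ 0 := fun h => hne ⟨0, hd⟩ (by simp [h])
  have hpos : 0 < ∏ i, |ξ i| ^ e i :=
    Finset.prod_pos fun i _ => Real.rpow_pos_of_pos (abs_pos.2 (hne i)) _
  refine (ENNReal.inv_le_inv.2
    (prod_abs_rpow_le_omegaW hd hθ0 (by linarith) hc0 hcd h0 hξ)).trans_eq ?_
  rw [← ENNReal.ofReal_inv_of_pos hpos, ← Finset.prod_inv_distrib]
  refine congrArg _ (Finset.prod_congr rfl fun i _ => ?_)
  have hi : |ξ i| ≤ ‖ξ‖ := PiLp.norm_apply_le ξ i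
  rw [Set.indicator_of_mem (Set.mem_Icc.2 (abs_le.1 (hi.trans hξ.le))), Real.rpow_neg (abs_nonneg _)]

theorem lintegral_inv_omegaW_lt_top (hd2 : 2 ≤ d) (hδ : 1 < δ)
    (hdim : 1 + δ - 2 * r < (d : ℝ)) (hs : (d : ℝ) / 2 < s) :
    ∫⁻ ξ, (omegaW d hd s r δ ξ)⁻¹ < ∞ := by
  rw [← lintegral_add_compl (A := Metric.ball 0 1) _ Metric.isOpen_ball.measurableSet]
  refine ENNReal.add_lt_top.2 ⟨setLIntegral_ball_inv_omegaW_lt_top hd hd2 hδ hdim, ?_⟩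
  have hint := integrable_rpow_neg_one_add_norm_sq (E := EuclideanSpace ℝ (Fin d))
    (μ := volume) (r := 2 * s) (by rw [finrank_euclideanSpace_fin]; linarith)
  refine lt_of_le_of_lt ((setLIntegral_mono' Metric.isOpen_ball.measurableSet.compl
    fun ξ hξ => ?_).trans (setLIntegral_le_lintegral _ _)) hint.lintegral_lt_top
  rw [Set.mem_compl_iff, mem_ball_zero_iff, not_lt] at hξ
  rw [omegaW_of_one_le_norm hd hξ, ← ENNReal.ofReal_inv_of_pos (by positivity),
    ← Real.rpow_neg (by positivity), neg_div, mul_div_cancel_left₀ _ two_ne_zero]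

theorem lintegral_sq_le_of_omegaW {f : EuclideanSpace ℝ (Fin d) → ℝ≥0∞}
    (hf : Measurable f) :
    (∫⁻ ξ, f ξ) ^ 2 ≤ (∫⁻ ξ, (omegaW d hd s r δ ξ)⁻¹) * ∫⁻ ξ, omegaW d hd s r δ ξ * f ξ ^ 2 := by
  have hω := measurable_omegaW hd (s := s) (r := r) (δ := δ)
  have h := sq_lintegral_mul_le volume
    (f := fun ξ => (omegaW d hd s r δ ξ)⁻¹ ^ (1 / 2 : ℝ))
    (g := fun ξ => omegaW d hd s r δ ξ ^ (1 / 2 : ℝ) * f ξ) (by fun_prop) (by fun_prop)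
  simp only [mul_pow, ENNReal.rpow_half_sq] at h
  refine le_trans (le_of_eq ?_) h
  congr 1
  refine lintegral_congr_ae ?_
  filter_upwards [ae_forall_apply_ne_zero] with ξ hξ
  have h0 : ξ ≠ 0 := fun h => hξ ⟨0, hd⟩ (by simp [h])
  rw [← mul_assoc, ← ENNReal.mul_rpow_of_nonneg _ _ (by norm_num),
    ENNReal.inv_mul_cancel (omegaW_ne_zero hd h0) (omegaW_ne_top hd ξ), ENNReal.one_rpow, one_mul]

end Integrability

section Algebra

variable {d : ℕ} (hd : 0 < d) {s r δ : ℝ}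

/-- The function `F / μ` restricted to the unit ball. -/
noncomputable def ballQuot (d : ℕ) (hd : 0 < d) (r δ : ℝ) (F : EuclideanSpace ℝ (Fin d) → ℝ) :
    EuclideanSpace ℝ (Fin d) → ℝ :=
  (Metric.ball 0 1).indicator fun ξ => F ξ / muW d hd r δ ξ

theorem measurable_ballQuot {F : EuclideanSpace ℝ (Fin d) → ℝ} (hF : Measurable F) :
    Measurable (ballQuot d hd r δ F) :=
  (hF.div (measurable_muW hd)).indicator Metric.isOpen_ball.measurableSet

theorem ballQuot_nonneg {F : EuclideanSpace ℝ (Fin d) → ℝ} (hF : ∀ ξ, 0 ≤ F ξ)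
    (ξ : EuclideanSpace ℝ (Fin d)) : 0 ≤ ballQuot d hd r δ F ξ :=
  Set.indicator_nonneg (fun ξ _ => div_nonneg (hF ξ) (muW_nonneg hd ξ)) ξ

theorem ballQuot_of_one_le_norm (F : EuclideanSpace ℝ (Fin d) → ℝ)
    {ξ : EuclideanSpace ℝ (Fin d)} (hξ : 1 ≤ ‖ξ‖) : ballQuot d hd r δ F ξ = 0 :=
  Set.indicator_of_notMem (by simpa using hξ) _

theorem ballQuot_of_norm_lt_one (F : EuclideanSpace ℝ (Fin d) → ℝ)
    {ξ : EuclideanSpace ℝ (Fin d)} (hξ : ‖ξ‖ < 1) :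
    ballQuot d hd r δ F ξ = F ξ / muW d hd r δ ξ :=
  Set.indicator_of_mem (by simpa using hξ) _

theorem lintegral_omegaW_mul_ballQuot_sq_le {F : EuclideanSpace ℝ (Fin d) → ℝ} :
    ∫⁻ ξ, omegaW d hd s r δ ξ * ENNReal.ofReal (ballQuot d hd r δ F ξ) ^ 2 ≤
      ∫⁻ ξ, ENNReal.ofReal (F ξ) ^ 2 := by
  refine lintegral_mono fun ξ => ?_
  rcases lt_or_ge ‖ξ‖ 1 with hξ | hξ
  · rw [ballQuot_of_norm_lt_one hd F hξ]
    calc omegaW d hd s r δ ξ * ENNReal.ofReal (F ξ / muW d hd r δ ξ) ^ 2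
        ≤ ENNReal.ofReal (muW d hd r δ ξ) ^ 2 * ENNReal.ofReal (F ξ / muW d hd r δ ξ) ^ 2 := by
          gcongr
          exact omegaW_le_muW_sq hd hξ
      _ = ENNReal.ofReal (muW d hd r δ ξ * (F ξ / muW d hd r δ ξ)) ^ 2 := by
          rw [← mul_pow, ENNReal.ofReal_mul (muW_nonneg hd ξ)]
      _ ≤ ENNReal.ofReal (F ξ) ^ 2 := by
          rcases (muW_nonneg hd ξ).eq_or_lt with h | h
          · rw [← h, zero_mul, ENNReal.ofReal_zero, zero_pow two_ne_zero]
            exact zero_le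
          · rw [mul_div_cancel₀ _ h.ne']
  · simp [ballQuot_of_one_le_norm hd F hξ]

theorem measurable_convNN {F G : EuclideanSpace ℝ (Fin d) → ℝ} (hF : Measurable F)
    (hG : Measurable G) : Measurable (convNN d F G) :=
  Measurable.lintegral_prod_right' (f := fun p : EuclideanSpace ℝ (Fin d) × _ =>
    ENNReal.ofReal (F (p.1 - p.2)) * ENNReal.ofReal (G p.2)) (by fun_prop)

theorem convNN_comm (F G : EuclideanSpace ℝ (Fin d) → ℝ) (ξ : EuclideanSpace ℝ (Fin d)) :
    convNN d F G ξ = convNN d G F ξ :=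
  lintegral_conv_comm volume (fun η => ENNReal.ofReal (F η)) (fun η => ENNReal.ofReal (G η)) ξ

theorem convNN_ballQuot_of_two_le_norm (F G : EuclideanSpace ℝ (Fin d) → ℝ)
    {ξ : EuclideanSpace ℝ (Fin d)} (hξ : 2 ≤ ‖ξ‖) :
    convNN d (ballQuot d hd r δ F) (ballQuot d hd r δ G) ξ = 0 := by
  rw [convNN, ← lintegral_zero]
  refine lintegral_congr fun η => ?_
  rcases lt_or_ge ‖η‖ 1 with hη | hη
  · rw [ballQuot_of_one_le_norm hd F (by linarith [norm_sub_norm_le ξ η]), ENNReal.ofReal_zero,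
      zero_mul]
  · rw [ballQuot_of_one_le_norm hd G hη, ENNReal.ofReal_zero, mul_zero]

theorem Itri_eq_lintegral {F G H : EuclideanSpace ℝ (Fin d) → ℝ}
    (hFm : Measurable F) (hF : ∀ ξ, 0 ≤ F ξ) (hGm : Measurable G) (hG : ∀ ξ, 0 ≤ G ξ)
    (hHm : Measurable H) :
    Itri d hd r δ F G H = ∫⁻ ξ, ENNReal.ofReal (muW d hd r δ ξ) *
      convNN d (ballQuot d hd r δ F) (ballQuot d hd r δ G) ξ * ENNReal.ofReal (H ξ) := by
  have hμ := measurable_muW hd (r := r) (δ := δ)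
  have hf := measurable_ballQuot hd (r := r) (δ := δ) hFm
  have hg := measurable_ballQuot hd (r := r) (δ := δ) hGm
  have key := lintegral_lintegral_add_mul volume
    (Φ := fun ξ => ENNReal.ofReal (muW d hd r δ ξ) * ENNReal.ofReal (H ξ))
    (f := fun ξ => ENNReal.ofReal (ballQuot d hd r δ F ξ))
    (g := fun ξ => ENNReal.ofReal (ballQuot d hd r δ G ξ))
    (by fun_prop) (by fun_prop) (by fun_prop)
  have hball := (Metric.isOpen_ball (x := (0 : EuclideanSpace ℝ (Fin d))) (ε := 1)).measurableSet
  calc Itri d hd r δ F G H = _ := ?_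
    _ = _ := key
    _ = _ := lintegral_congr fun ξ => by rw [mul_right_comm, convNN]
  rw [Itri, ← lintegral_indicator hball]
  refine lintegral_congr fun ξ => ?_
  by_cases hξ : ξ ∈ Metric.ball 0 1
  swap
  · rw [Set.indicator_of_notMem hξ]
    rw [mem_ball_zero_iff, not_lt] at hξ
    simp [ballQuot_of_one_le_norm hd F hξ]
  rw [Set.indicator_of_mem hξ, ← lintegral_indicator hball]
  refine lintegral_congr fun η => ?_
  by_cases hη : η ∈ Metric.ball 0 1
  swap
  · rw [Set.indicator_of_notMem hη]
    rw [mem_ball_zero_iff, not_lt] at hη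
    simp [ballQuot_of_one_le_norm hd G hη]
  rw [Set.indicator_of_mem hη]
  rw [mem_ball_zero_iff] at hξ hη
  rw [ballQuot_of_norm_lt_one hd F hξ, ballQuot_of_norm_lt_one hd G hη, div_eq_mul_inv (F ξ),
    div_eq_mul_inv (G η), ENNReal.ofReal_mul (hF ξ), ENNReal.ofReal_mul (hG η), div_eq_mul_inv,
    mul_inv, ENNReal.ofReal_mul (muW_nonneg hd _),
    ENNReal.ofReal_mul (inv_nonneg.2 (muW_nonneg hd _))]
  ring

theorem exists_Itri_le_of_algebra (hδ : 0 ≤ δ) (hs : 0 ≤ s) {C : ℝ}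
    (h : ∀ F G : EuclideanSpace ℝ (Fin d) → ℝ,
      Measurable F → (∀ ξ, 0 ≤ F ξ) → Measurable G → (∀ ξ, 0 ≤ G ξ) →
      (∫⁻ ξ, omegaW d hd s r δ ξ * (convNN d F G ξ) ^ 2) ≤
      ENNReal.ofReal C ^ 2 *
        ((∫⁻ ξ, omegaW d hd s r δ ξ * ENNReal.ofReal (F ξ) ^ 2) *
         (∫⁻ ξ, omegaW d hd s r δ ξ * ENNReal.ofReal (G ξ) ^ 2))) :
    ∃ C : ℝ, 0 < C ∧ ∀ F G H : EuclideanSpace ℝ (Fin d) → ℝ,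
      Measurable F → (∀ ξ, 0 ≤ F ξ) → Measurable G → (∀ ξ, 0 ≤ G ξ) → Measurable H →
      Itri d hd r δ F G H ≤
        ENNReal.ofReal C * ((∫⁻ ξ, ENNReal.ofReal (F ξ) ^ 2) ^ (1/2 : ℝ) *
          ((∫⁻ ξ, ENNReal.ofReal (G ξ) ^ 2) ^ (1/2 : ℝ) *
           (∫⁻ ξ, ENNReal.ofReal (H ξ) ^ 2) ^ (1/2 : ℝ))) := by
  obtain ⟨K, hK, hKω⟩ := exists_muW_sq_le_omegaW hd (r := r) hδ hs
  obtain ⟨C', hC'0, hC'⟩ := ENNReal.exists_le_ofReal_sq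
    (M := K * ENNReal.ofReal C ^ 2) (by finiteness)
  refine ⟨C', hC'0, fun F G H hFm hF hGm hG hHm => ENNReal.le_of_sq_le_sq ?_⟩
  have hμ := measurable_muW hd (r := r) (δ := δ)
  have hfm := measurable_ballQuot hd (r := r) (δ := δ) hFm
  have hgm := measurable_ballQuot hd (r := r) (δ := δ) hGm
  have hconv := measurable_convNN hfm hgm
  simp only [mul_pow, ENNReal.rpow_half_sq]
  rw [Itri_eq_lintegral hd hFm hF hGm hG hHm]
  calc _ ≤ _ := sq_lintegral_mul_le volume (by fun_prop) (by fun_prop)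
    _ ≤ (K * ∫⁻ ξ, omegaW d hd s r δ ξ *
          convNN d (ballQuot d hd r δ F) (ballQuot d hd r δ G) ξ ^ 2) *
            ∫⁻ ξ, ENNReal.ofReal (H ξ) ^ 2 := by
      gcongr
      rw [← lintegral_const_mul' _ _ hK]
      refine lintegral_mono fun ξ => ?_
      rcases lt_or_ge ‖ξ‖ 2 with hξ | hξ
      · rw [mul_pow, ← mul_assoc]
        gcongr
        exact hKω ξ hξ
      · simp [convNN_ballQuot_of_two_le_norm hd F G hξ]
    _ ≤ (K * (ENNReal.ofReal C ^ 2 *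
          ((∫⁻ ξ, ENNReal.ofReal (F ξ) ^ 2) * ∫⁻ ξ, ENNReal.ofReal (G ξ) ^ 2))) *
            ∫⁻ ξ, ENNReal.ofReal (H ξ) ^ 2 := by
      gcongr
      refine (h _ _ hfm (ballQuot_nonneg hd hF) hgm (ballQuot_nonneg hd hG)).trans ?_
      gcongr _ * (?_ * ?_) <;> exact lintegral_omegaW_mul_ballQuot_sq_le hd
    _ = (K * ENNReal.ofReal C ^ 2) * ((∫⁻ ξ, ENNReal.ofReal (F ξ) ^ 2) *
          ((∫⁻ ξ, ENNReal.ofReal (G ξ) ^ 2) * ∫⁻ ξ, ENNReal.ofReal (H ξ) ^ 2)) := by ring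
    _ ≤ _ := by gcongr

/-- The function `μ F` restricted to the unit ball. -/
noncomputable def ballMul (d : ℕ) (hd : 0 < d) (r δ : ℝ) (F : EuclideanSpace ℝ (Fin d) → ℝ) :
    EuclideanSpace ℝ (Fin d) → ℝ :=
  (Metric.ball 0 1).indicator fun ξ => muW d hd r δ ξ * F ξ

theorem measurable_ballMul {F : EuclideanSpace ℝ (Fin d) → ℝ} (hF : Measurable F) :
    Measurable (ballMul d hd r δ F) :=
  ((measurable_muW hd).mul hF).indicator Metric.isOpen_ball.measurableSet

theorem ballMul_nonneg {F : EuclideanSpace ℝ (Fin d) → ℝ} (hF : ∀ ξ, 0 ≤ F ξ)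
    (ξ : EuclideanSpace ℝ (Fin d)) : 0 ≤ ballMul d hd r δ F ξ :=
  Set.indicator_nonneg (fun ξ _ => mul_nonneg (muW_nonneg hd ξ) (hF ξ)) ξ

theorem lintegral_ballMul_sq_le (F : EuclideanSpace ℝ (Fin d) → ℝ) :
    ∫⁻ ξ, ENNReal.ofReal (ballMul d hd r δ F ξ) ^ 2 ≤
      2 * ∫⁻ ξ, omegaW d hd s r δ ξ * ENNReal.ofReal (F ξ) ^ 2 := by
  rw [← lintegral_const_mul' _ _ ENNReal.ofNat_ne_top]
  refine lintegral_mono fun ξ => ?_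
  rw [ballMul]
  by_cases hξ : ξ ∈ Metric.ball 0 1
  · rw [Set.indicator_of_mem hξ, ENNReal.ofReal_mul (muW_nonneg hd ξ), mul_pow, ← mul_assoc]
    gcongr
    exact muW_sq_le_omegaW hd (by simpa using hξ)
  · simp [hξ]

theorem ballQuot_ballMul (F : EuclideanSpace ℝ (Fin d) → ℝ) {ξ : EuclideanSpace ℝ (Fin d)}
    (h0 : ξ ≠ 0) (hξ : ‖ξ‖ < 1) : ballQuot d hd r δ (ballMul d hd r δ F) ξ = F ξ := by
  rw [ballQuot_of_norm_lt_one hd _ hξ, ballMul, Set.indicator_of_mem (by simpa using hξ),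
    mul_div_cancel_left₀ _ (muW_pos hd h0).ne']

/-- The trilinear estimate controls the interaction of low frequencies into low frequencies. -/
theorem setLIntegral_ball_convNN_sq_le {C : ℝ}
    (h : ∀ F G H : EuclideanSpace ℝ (Fin d) → ℝ,
      Measurable F → (∀ ξ, 0 ≤ F ξ) → Measurable G → (∀ ξ, 0 ≤ G ξ) →
      Measurable H → (∀ ξ, 0 ≤ H ξ) →
      (∫⁻ ξ, ENNReal.ofReal (F ξ) ^ 2) < ⊤ →
      (∫⁻ ξ, ENNReal.ofReal (G ξ) ^ 2) < ⊤ →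
      (∫⁻ ξ, ENNReal.ofReal (H ξ) ^ 2) < ⊤ →
      Itri d hd r δ F G H ≤
        ENNReal.ofReal C * ((∫⁻ ξ, ENNReal.ofReal (F ξ) ^ 2) ^ (1/2 : ℝ) *
          ((∫⁻ ξ, ENNReal.ofReal (G ξ) ^ 2) ^ (1/2 : ℝ) *
           (∫⁻ ξ, ENNReal.ofReal (H ξ) ^ 2) ^ (1/2 : ℝ))))
    {F G : EuclideanSpace ℝ (Fin d) → ℝ}
    (hFm : Measurable F) (hF : ∀ ξ, 0 ≤ F ξ) (hGm : Measurable G) (hG : ∀ ξ, 0 ≤ G ξ)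
    (hFfin : ∫⁻ ξ, ENNReal.ofReal (F ξ) ^ 2 < ∞) (hGfin : ∫⁻ ξ, ENNReal.ofReal (G ξ) ^ 2 < ∞) :
    ∫⁻ ξ in Metric.ball 0 1, omegaW d hd s r δ ξ *
        convNN d (ballQuot d hd r δ F) (ballQuot d hd r δ G) ξ ^ 2 ≤
      ENNReal.ofReal C ^ 2 *
        ((∫⁻ ξ, ENNReal.ofReal (F ξ) ^ 2) * ∫⁻ ξ, ENNReal.ofReal (G ξ) ^ 2) := by
  have hμ := measurable_muW hd (r := r) (δ := δ)
  have hconv := measurable_convNN (measurable_ballQuot hd (r := r) (δ := δ) hFm)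
    (measurable_ballQuot hd (r := r) (δ := δ) hGm)
  have hball := (Metric.isOpen_ball (x := (0 : EuclideanSpace ℝ (Fin d))) (ε := 1)).measurableSet
  have key := setLIntegral_sq_le_of_forall_lintegral_mul_le (μ := volume)
    (u := fun ξ => ENNReal.ofReal (muW d hd r δ ξ) *
      convNN d (ballQuot d hd r δ F) (ballQuot d hd r δ G) ξ) (by fun_prop) hball
    measure_ball_lt_top.ne
    (A := ENNReal.ofReal C * ((∫⁻ ξ, ENNReal.ofReal (F ξ) ^ 2) ^ (1/2 : ℝ) *
      (∫⁻ ξ, ENNReal.ofReal (G ξ) ^ 2) ^ (1/2 : ℝ))) fun H hHm hH hHfin => by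
        rw [← Itri_eq_lintegral hd hFm hF hGm hG hHm, mul_assoc, mul_assoc]
        exact h F G H hFm hF hGm hG hHm hH hFfin hGfin hHfin
  simp only [mul_pow, ENNReal.rpow_half_sq] at key
  refine (setLIntegral_mono' hball fun ξ hξ => ?_).trans key
  gcongr
  exact omegaW_le_muW_sq hd (by simpa using hξ)

theorem exists_omegaW_rpow_half_add_le (hδ : 1 < δ) (hr : r ≤ 1) (hs : 0 ≤ s) :
    ∃ K : ℝ≥0∞, K ≠ ∞ ∧ ∀ x y : EuclideanSpace ℝ (Fin d),
      ¬(‖x‖ < 1 ∧ ‖y‖ < 1 ∧ ‖x + y‖ < 1) →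
        omegaW d hd s r δ (x + y) ^ (1 / 2 : ℝ) ≤
          K * (omegaW d hd s r δ x ^ (1 / 2 : ℝ) + omegaW d hd s r δ y ^ (1 / 2 : ℝ)) := by
  refine ⟨ENNReal.ofReal (2 * (5 ^ s * 2 ^ (2 * δ - 2 * r))) ^ (1 / 2 : ℝ), by finiteness,
    fun x y h => ?_⟩
  rw [mul_add, ← ENNReal.mul_rpow_of_nonneg _ _ (by norm_num),
    ← ENNReal.mul_rpow_of_nonneg _ _ (by norm_num)]
  rcases le_total ‖y‖ ‖x‖ with hyx | hxy
  · refine le_trans ?_ le_self_add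
    gcongr
    exact omegaW_add_le hd hδ hr hs hyx fun h' => h ⟨h'.1, hyx.trans_lt h'.1, h'.2⟩
  · refine le_trans ?_ le_add_self
    gcongr
    rw [add_comm x y] at h ⊢
    exact omegaW_add_le hd hδ hr hs hxy fun h' => h ⟨hxy.trans_lt h'.1, h'.1, h'.2⟩

theorem convNN_eq_zero {F G : EuclideanSpace ℝ (Fin d) → ℝ} (hG : Measurable G)
    (h : ∫⁻ ξ, ENNReal.ofReal (G ξ) = 0) (ξ : EuclideanSpace ℝ (Fin d)) :
    convNN d F G ξ = 0 := by
  rw [lintegral_eq_zero_iff (by fun_prop)] at h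
  rw [convNN, ← lintegral_zero]
  refine lintegral_congr_ae ?_
  filter_upwards [h] with η hη
  rw [hη, Pi.zero_apply, mul_zero]

/-- Pointwise splitting of a weighted convolution into its purely low-frequency part and terms in
which the weight falls on one of the factors. -/
theorem omegaW_rpow_half_mul_convNN_le {K : ℝ≥0∞} (hK : ∀ x y : EuclideanSpace ℝ (Fin d),
      ¬(‖x‖ < 1 ∧ ‖y‖ < 1 ∧ ‖x + y‖ < 1) →
        omegaW d hd s r δ (x + y) ^ (1 / 2 : ℝ) ≤
          K * (omegaW d hd s r δ x ^ (1 / 2 : ℝ) + omegaW d hd s r δ y ^ (1 / 2 : ℝ)))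
    {F G : EuclideanSpace ℝ (Fin d) → ℝ} (hF : Measurable F) (hG : Measurable G)
    (x : EuclideanSpace ℝ (Fin d)) :
    omegaW d hd s r δ x ^ (1 / 2 : ℝ) * convNN d F G x ≤
      (Metric.ball 0 1).indicator (fun x => omegaW d hd s r δ x ^ (1 / 2 : ℝ) *
        convNN d (ballQuot d hd r δ (ballMul d hd r δ F))
          (ballQuot d hd r δ (ballMul d hd r δ G)) x) x +
      K * ((∫⁻ y, omegaW d hd s r δ (x - y) ^ (1 / 2 : ℝ) * ENNReal.ofReal (F (x - y)) *
          ENNReal.ofReal (G y)) +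
        ∫⁻ y, ENNReal.ofReal (F (x - y)) *
          (omegaW d hd s r δ y ^ (1 / 2 : ℝ) * ENNReal.ofReal (G y))) := by
  have hω := measurable_omegaW hd (s := s) (r := r) (δ := δ)
  have hf := measurable_ballQuot hd (r := r) (δ := δ) (measurable_ballMul hd (r := r) (δ := δ) hF)
  have hg := measurable_ballQuot hd (r := r) (δ := δ) (measurable_ballMul hd (r := r) (δ := δ) hG)
  have hne : ∀ z : EuclideanSpace ℝ (Fin d), ∀ᵐ y, y ≠ z := fun z => by
    have : NeZero d := ⟨hd.ne'⟩
    exact Measure.ae_ne volume z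
  have hsplit : ∀ y, ¬(‖x - y‖ < 1 ∧ ‖y‖ < 1 ∧ ‖x‖ < 1) →
      omegaW d hd s r δ x ^ (1 / 2 : ℝ) *
          (ENNReal.ofReal (F (x - y)) * ENNReal.ofReal (G y)) ≤
        K * (omegaW d hd s r δ (x - y) ^ (1 / 2 : ℝ) * ENNReal.ofReal (F (x - y)) *
            ENNReal.ofReal (G y) +
          ENNReal.ofReal (F (x - y)) *
            (omegaW d hd s r δ y ^ (1 / 2 : ℝ) * ENNReal.ofReal (G y))) := fun y hy => by
    have := hK (x - y) y (by rwa [sub_add_cancel])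
    rw [sub_add_cancel] at this
    calc _ ≤ K * (omegaW d hd s r δ (x - y) ^ (1 / 2 : ℝ) +
            omegaW d hd s r δ y ^ (1 / 2 : ℝ)) *
          (ENNReal.ofReal (F (x - y)) * ENNReal.ofReal (G y)) := by gcongr
      _ = _ := by ring
  have hmeas : Measurable fun y => omegaW d hd s r δ (x - y) ^ (1 / 2 : ℝ) *
      ENNReal.ofReal (F (x - y)) * ENNReal.ofReal (G y) := by fun_prop
  rw [← lintegral_add_left hmeas, ← lintegral_const_mul _ (by fun_prop), convNN,
    ← lintegral_const_mul _ (by fun_prop)]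
  by_cases hx : x ∈ Metric.ball 0 1
  · rw [Set.indicator_of_mem hx, convNN, ← lintegral_const_mul _ (by fun_prop),
      ← lintegral_add_left (by fun_prop)]
    refine lintegral_mono_ae ?_
    filter_upwards [hne 0, hne x] with y hy0 hyx
    by_cases h : ‖x - y‖ < 1 ∧ ‖y‖ < 1 ∧ ‖x‖ < 1
    · rw [ballQuot_ballMul hd F (sub_ne_zero.2 hyx.symm) h.1, ballQuot_ballMul hd G hy0 h.2.1]
      exact le_self_add
    · exact (hsplit y h).trans le_add_self
  · rw [Set.indicator_of_notMem hx, zero_add]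
    exact lintegral_mono fun y => hsplit y fun h => hx (by simpa using h.2.2)

theorem exists_algebra_of_Itri_le (hd2 : 2 ≤ d) (hδ : 1 < δ)
    (hdim : 1 + δ - 2 * r < (d : ℝ)) (hr : r ≤ 1) (hs : (d : ℝ) / 2 < s) {C : ℝ}
    (h : ∀ F G H : EuclideanSpace ℝ (Fin d) → ℝ,
      Measurable F → (∀ ξ, 0 ≤ F ξ) → Measurable G → (∀ ξ, 0 ≤ G ξ) →
      Measurable H → (∀ ξ, 0 ≤ H ξ) →
      (∫⁻ ξ, ENNReal.ofReal (F ξ) ^ 2) < ⊤ →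
      (∫⁻ ξ, ENNReal.ofReal (G ξ) ^ 2) < ⊤ →
      (∫⁻ ξ, ENNReal.ofReal (H ξ) ^ 2) < ⊤ →
      Itri d hd r δ F G H ≤
        ENNReal.ofReal C * ((∫⁻ ξ, ENNReal.ofReal (F ξ) ^ 2) ^ (1/2 : ℝ) *
          ((∫⁻ ξ, ENNReal.ofReal (G ξ) ^ 2) ^ (1/2 : ℝ) *
           (∫⁻ ξ, ENNReal.ofReal (H ξ) ^ 2) ^ (1/2 : ℝ)))) :
    ∃ C : ℝ, 0 < C ∧ ∀ F G : EuclideanSpace ℝ (Fin d) → ℝ,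
      Measurable F → (∀ ξ, 0 ≤ F ξ) → Measurable G → (∀ ξ, 0 ≤ G ξ) →
      (∫⁻ ξ, omegaW d hd s r δ ξ * (convNN d F G ξ) ^ 2) ≤
      ENNReal.ofReal C ^ 2 *
        ((∫⁻ ξ, omegaW d hd s r δ ξ * ENNReal.ofReal (F ξ) ^ 2) *
         (∫⁻ ξ, omegaW d hd s r δ ξ * ENNReal.ofReal (G ξ) ^ 2)) := by
  have hs0 : 0 ≤ s := le_trans (by positivity) hs.le
  obtain ⟨K, hK, hKω⟩ := exists_omegaW_rpow_half_add_le hd hδ hr hs0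
  set A := ∫⁻ ξ, (omegaW d hd s r δ ξ)⁻¹
  have hAfin : A ≠ ∞ := (lintegral_inv_omegaW_lt_top hd hd2 hδ hdim hs).ne
  obtain ⟨C', hC'0, hC'⟩ := ENNReal.exists_le_ofReal_sq
    (M := 2 * (ENNReal.ofReal C ^ 2 * 4 + K ^ 2 * (4 * A))) (by finiteness)
  refine ⟨C', hC'0, fun F G hFm hF hGm hG => ?_⟩
  have hω := measurable_omegaW hd (s := s) (r := r) (δ := δ)
  have hL1 : ∀ {f : EuclideanSpace ℝ (Fin d) → ℝ}, Measurable f →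
      (∫⁻ ξ, ENNReal.ofReal (f ξ)) ^ 2 ≤
        A * ∫⁻ ξ, omegaW d hd s r δ ξ * ENNReal.ofReal (f ξ) ^ 2 := fun hf =>
    lintegral_sq_le_of_omegaW hd (by fun_prop)
  have hFL1 := hL1 hFm
  have hGL1 := hL1 hGm
  have hFb := lintegral_ballMul_sq_le hd (s := s) (r := r) (δ := δ) F
  have hGb := lintegral_ballMul_sq_le hd (s := s) (r := r) (δ := δ) G
  set a := ∫⁻ ξ, omegaW d hd s r δ ξ * ENNReal.ofReal (F ξ) ^ 2
  set b := ∫⁻ ξ, omegaW d hd s r δ ξ * ENNReal.ofReal (G ξ) ^ 2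
  rcases eq_or_ne a 0 with ha0 | ha0
  · have : ∫⁻ ξ, ENNReal.ofReal (F ξ) = 0 := by simpa [ha0] using hFL1
    simp [convNN_comm F G, convNN_eq_zero hFm this]
  rcases eq_or_ne b 0 with hb0 | hb0
  · have : ∫⁻ ξ, ENNReal.ofReal (G ξ) = 0 := by simpa [hb0] using hGL1
    simp [convNN_eq_zero hGm this]
  have hC'ne : ENNReal.ofReal C' ^ 2 ≠ 0 := by simpa using hC'0
  rcases eq_or_ne a ∞ with haT | haT
  · rw [haT, ENNReal.top_mul hb0, ENNReal.mul_top hC'ne]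
    exact le_top
  rcases eq_or_ne b ∞ with hbT | hbT
  · rw [hbT, ENNReal.mul_top ha0, ENNReal.mul_top hC'ne]
    exact le_top
  have hFbm := measurable_ballMul hd (r := r) (δ := δ) hFm
  have hGbm := measurable_ballMul hd (r := r) (δ := δ) hGm
  have hlow := setLIntegral_ball_convNN_sq_le hd (s := s) h hFbm (ballMul_nonneg hd hF) hGbm
    (ballMul_nonneg hd hG) (hFb.trans_lt (by finiteness)) (hGb.trans_lt (by finiteness))
  have hball := (Metric.isOpen_ball (x := (0 : EuclideanSpace ℝ (Fin d))) (ε := 1)).measurableSet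
  set L : EuclideanSpace ℝ (Fin d) → ℝ≥0∞ := (Metric.ball 0 1).indicator fun x =>
    omegaW d hd s r δ x ^ (1 / 2 : ℝ) * convNN d (ballQuot d hd r δ (ballMul d hd r δ F))
      (ballQuot d hd r δ (ballMul d hd r δ G)) x with hL
  have hLm : Measurable L := by
    have := measurable_convNN (measurable_ballQuot hd (r := r) (δ := δ) hFbm)
      (measurable_ballQuot hd (r := r) (δ := δ) hGbm)
    exact Measurable.indicator (by fun_prop) hball
  have hLint : ∫⁻ x, L x ^ 2 ≤ ENNReal.ofReal C ^ 2 * 4 * (a * b) := calc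
    ∫⁻ x, L x ^ 2 = ∫⁻ x in Metric.ball (0 : EuclideanSpace ℝ (Fin d)) 1, L x ^ 2 := by
      rw [← lintegral_indicator hball]
      refine lintegral_congr fun x => ?_
      by_cases hx : x ∈ Metric.ball 0 1
      · rw [Set.indicator_of_mem hx]
      · rw [Set.indicator_of_notMem hx, hL, Set.indicator_of_notMem hx, zero_pow two_ne_zero]
    _ = _ := by
      refine setLIntegral_congr_fun hball fun x hx => ?_
      simp only [hL]
      rw [Set.indicator_of_mem hx, mul_pow, ENNReal.rpow_half_sq]
    _ ≤ _ := hlow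
    _ ≤ ENNReal.ofReal C ^ 2 * ((2 * a) * (2 * b)) := by gcongr
    _ = _ := by ring
  set P : EuclideanSpace ℝ (Fin d) → ℝ≥0∞ := fun x =>
    ∫⁻ y, omegaW d hd s r δ (x - y) ^ (1 / 2 : ℝ) * ENNReal.ofReal (F (x - y)) *
      ENNReal.ofReal (G y)
  set Q : EuclideanSpace ℝ (Fin d) → ℝ≥0∞ := fun x =>
    ∫⁻ y, ENNReal.ofReal (F (x - y)) *
      (omegaW d hd s r δ y ^ (1 / 2 : ℝ) * ENNReal.ofReal (G y))
  have hPm : Measurable P := Measurable.lintegral_prod_right'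
    (f := fun p : EuclideanSpace ℝ (Fin d) × EuclideanSpace ℝ (Fin d) =>
      omegaW d hd s r δ (p.1 - p.2) ^ (1 / 2 : ℝ) * ENNReal.ofReal (F (p.1 - p.2)) *
        ENNReal.ofReal (G p.2)) (by fun_prop)
  have hPint : ∫⁻ x, P x ^ 2 ≤ A * (a * b) := by
    refine (lintegral_conv_sq_le volume
      (f := fun x => omegaW d hd s r δ x ^ (1 / 2 : ℝ) * ENNReal.ofReal (F x))
      (g := fun y => ENNReal.ofReal (G y)) (by fun_prop) (by fun_prop)).trans ?_
    simp only [mul_pow, ENNReal.rpow_half_sq]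
    calc _ ≤ (A * b) * a := by gcongr
      _ = _ := by ring
  have hQint : ∫⁻ x, Q x ^ 2 ≤ A * (a * b) := by
    have hQ : ∀ x, Q x = _ := lintegral_conv_comm volume (fun x => ENNReal.ofReal (F x))
      fun y => omegaW d hd s r δ y ^ (1 / 2 : ℝ) * ENNReal.ofReal (G y)
    simp only [hQ]
    refine (lintegral_conv_sq_le volume
      (f := fun x => omegaW d hd s r δ x ^ (1 / 2 : ℝ) * ENNReal.ofReal (G x))
      (g := fun y => ENNReal.ofReal (F y)) (by fun_prop) (by fun_prop)).trans ?_
    simp only [mul_pow, ENNReal.rpow_half_sq]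
    calc _ ≤ (A * a) * b := by gcongr
      _ = _ := by ring
  calc ∫⁻ x, omegaW d hd s r δ x * convNN d F G x ^ 2
      ≤ ∫⁻ x, 2 * (L x ^ 2 + K ^ 2 * (2 * (P x ^ 2 + Q x ^ 2))) := by
        refine lintegral_mono fun x => ?_
        have hx := omegaW_rpow_half_mul_convNN_le hd hKω hFm hGm x
        calc omegaW d hd s r δ x * convNN d F G x ^ 2
            = (omegaW d hd s r δ x ^ (1 / 2 : ℝ) * convNN d F G x) ^ 2 := by
              rw [mul_pow, ENNReal.rpow_half_sq]
          _ ≤ (L x + K * (P x + Q x)) ^ 2 := by gcongr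
          _ ≤ 2 * (L x ^ 2 + (K * (P x + Q x)) ^ 2) := ENNReal.add_sq_le_two_mul _ _
          _ ≤ _ := by
            rw [mul_pow]
            gcongr
            exact ENNReal.add_sq_le_two_mul _ _
    _ = 2 * ((∫⁻ x, L x ^ 2) + K ^ 2 * (2 * ((∫⁻ x, P x ^ 2) + ∫⁻ x, Q x ^ 2))) := by
        rw [lintegral_const_mul' _ _ (by finiteness), lintegral_add_left (by fun_prop),
          lintegral_const_mul' _ _ (by finiteness), lintegral_const_mul' _ _ (by finiteness),
          lintegral_add_left (by fun_prop)]
    _ ≤ 2 * (ENNReal.ofReal C ^ 2 * 4 * (a * b) +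
          K ^ 2 * (2 * (A * (a * b) + A * (a * b)))) := by gcongr
    _ = 2 * (ENNReal.ofReal C ^ 2 * 4 + K ^ 2 * (4 * A)) * (a * b) := by ring
    _ ≤ _ := by gcongr

end Algebra

theorem stmt10 (d : ℕ) (hd : 2 ≤ d) (s r δ : ℝ) (hδ : 1 < δ)
    (hdim : 1 + δ - 2 * r < (d : ℝ)) (hr : r ≤ 1) (hs : (d : ℝ) / 2 < s) :
    (∃ C : ℝ, 0 < C ∧ ∀ F G : EuclideanSpace ℝ (Fin d) → ℝ,
      Measurable F → (∀ ξ, 0 ≤ F ξ) → Measurable G → (∀ ξ, 0 ≤ G ξ) →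
      (∫⁻ ξ, omegaW d (by omega) s r δ ξ * (convNN d F G ξ) ^ 2) ≤
      ENNReal.ofReal C ^ 2 *
        ((∫⁻ ξ, omegaW d (by omega) s r δ ξ * ENNReal.ofReal (F ξ) ^ 2) *
         (∫⁻ ξ, omegaW d (by omega) s r δ ξ * ENNReal.ofReal (G ξ) ^ 2))) ↔
    (∃ C : ℝ, 0 < C ∧ ∀ F G H : EuclideanSpace ℝ (Fin d) → ℝ,
      Measurable F → (∀ ξ, 0 ≤ F ξ) → Measurable G → (∀ ξ, 0 ≤ G ξ) →
      Measurable H → (∀ ξ, 0 ≤ H ξ) →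
      (∫⁻ ξ, ENNReal.ofReal (F ξ) ^ 2) < ⊤ →
      (∫⁻ ξ, ENNReal.ofReal (G ξ) ^ 2) < ⊤ →
      (∫⁻ ξ, ENNReal.ofReal (H ξ) ^ 2) < ⊤ →
      Itri d (by omega) r δ F G H ≤
        ENNReal.ofReal C * ((∫⁻ ξ, ENNReal.ofReal (F ξ) ^ 2) ^ (1/2 : ℝ) *
          ((∫⁻ ξ, ENNReal.ofReal (G ξ) ^ 2) ^ (1/2 : ℝ) *
           (∫⁻ ξ, ENNReal.ofReal (H ξ) ^ 2) ^ (1/2 : ℝ)))) := by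
  have hs0 : 0 ≤ s := le_trans (by positivity) hs.le
  constructor
  · rintro ⟨C, -, h⟩
    obtain ⟨C', hC', h'⟩ := exists_Itri_le_of_algebra (by omega) (by linarith) hs0 h
    exact ⟨C', hC', fun F G H hFm hF hGm hG hHm _ _ _ _ => h' F G H hFm hF hGm hG hHm⟩
  · rintro ⟨C, -, h⟩
    exact exists_algebra_of_Itri_le (by omega) hd hδ hdim hr hs h
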